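/- Let $(X,\mathcal{B}_X,\mu,T)$ be a $\mathbb{Z}^2$-MPS, $\vec v=(1,\beta)\in\mathbb{R}^2$ a direction vector and $b\in(0,\infty)$. For every pair of finite measurable partitions $\alpha,\eta$ of $X$ there exists an infinite subset $S''=\{(m''_i,n''_i)\}_{i=1}^\infty$ of $\Lambda^{\vec v}(b)$ with $\{m''_i\}_{i=1}^\infty$ strictly monotone such that $\liminf_{i\to\infty}H_\mu(T^{-(m''_i,n''_i)}\alpha\mid\eta)\ge H_\mu(\alpha\mid\mathcal{K}^{\vec v}_\mu)$. -/

import Mathlib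

open MeasureTheory Filter Set
open scoped ENNReal Topology

namespace Directional

noncomputable section

attribute [local instance] Classical.propDecidable

variable {X : Type*} [MeasurableSpace X] {G : Type*}

/-- The set of Koopman images `U_T^w 1_B` for `w ∈ Λ`, as elements of `L²(μ)`. -/
def korbit (μ : Measure X) (T : G → X → X) (Λ : Set G) (B : Set X) :
    Set (Lp ℝ 2 μ) :=
  {g | ∃ w ∈ Λ, (g : X → ℝ) =ᵐ[μ] fun x => B.indicator (fun _ => (1 : ℝ)) (T w x)}

/-- A finite measurable partition of `X`. -/
def IsPartition (α : Finset (Set X)) : Prop :=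
  (∀ A ∈ α, MeasurableSet A) ∧ ((α : Set (Set X)).PairwiseDisjoint id) ∧
    ⋃₀ (α : Set (Set X)) = Set.univ

/-- Static entropy `H_μ(α) = -∑ μ(A) log μ(A)`. -/
def partEnt (μ : Measure X) (α : Finset (Set X)) : ℝ :=
  ∑ A ∈ α, Real.negMulLog (μ A).toReal

/-- The join `⋁_{i=1}^k T^{-w_i} α`. -/
def seqJoin (T : G → X → X) (w : ℕ → G) (α : Finset (Set X)) : ℕ → Finset (Set X)
  | 0 => {Set.univ}
  | k + 1 => ((seqJoin T w α k) ×ˢ α).image fun p => p.1 ∩ (T (w k) ⁻¹' p.2)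

/-- Sequence entropy `h^S_μ(T, α)` along the sequence `w` for the partition `α`. -/
def seqEnt (μ : Measure X) (T : G → X → X) (w : ℕ → G) (α : Finset (Set X)) : ℝ :=
  Filter.atTop.limsup fun k : ℕ => partEnt μ (seqJoin T w α k) / (k : ℝ)

/-- Sequence entropy `h^S_μ(T)`, as the supremum over all finite measurable
partitions (valued in `ℝ≥0∞`). -/
def seqEntSup (μ : Measure X) (T : G → X → X) (w : ℕ → G) : ℝ≥0∞ :=
  ⨆ α : {α : Finset (Set X) // IsPartition α}, ENNReal.ofReal (seqEnt μ T w α)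

/-- `w : ℕ → G` is an enumeration of an infinite subset of `Λ`. -/
def EnumIn (w : ℕ → G) (Λ : Set G) : Prop :=
  Function.Injective w ∧ ∀ i, w i ∈ Λ

/-- Conditional entropy `H_μ(α | F)` with respect to a sub-σ-algebra `F`. -/
def condEntAlg (μ : Measure X) (F : MeasurableSpace X) (α : Finset (Set X)) : ℝ :=
  ∑ A ∈ α, ∫ x, Real.negMulLog ((μ[A.indicator (fun _ => (1 : ℝ)) | F]) x) ∂μ

/-- Conditional entropy `H_μ(α | η)` of a partition given another partition. -/
def condEntPart (μ : Measure X) (α η : Finset (Set X)) : ℝ :=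
  -∑ A ∈ α, ∑ D ∈ η,
    (μ (A ∩ D)).toReal * Real.log ((μ (A ∩ D)).toReal / (μ D).toReal)

/-- A `ℤ²`-measure-preserving system: an action of `ℤ²` by homeomorphisms
(continuous maps with continuous inverses `T (-w)`), preserving `μ`. -/
def IsZ2MPS [TopologicalSpace X] (μ : Measure X) (T : ℤ × ℤ → X → X) : Prop :=
  (∀ w, Continuous (T w)) ∧ T 0 = _root_.id ∧ (∀ v w, T (v + w) = T v ∘ T w) ∧
    ∀ w, MeasurePreserving (T w) μ μ

/-- The strip `Λ^{(1,β)}(b) = {(m,n) : βm - b/2 ≤ n ≤ βm + b/2}`. -/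
def Lam (β b : ℝ) : Set (ℤ × ℤ) :=
  {p | β * (p.1 : ℝ) - b / 2 ≤ (p.2 : ℝ) ∧ (p.2 : ℝ) ≤ β * (p.1 : ℝ) + b / 2}

/-- The `(1,β)`-directional Kronecker algebra with width parameter `b`. -/
def dirKron (μ : Measure X) (T : ℤ × ℤ → X → X) (β b : ℝ) : Set (Set X) :=
  {B | MeasurableSet B ∧ IsCompact (closure (korbit μ T (Lam β b) B))}

/-- The directional Kronecker algebra as a σ-algebra (using width `b = 1`,
which is immaterial since `dirKron` is independent of `b`). -/
def dirKronAlg (μ : Measure X) (T : ℤ × ℤ → X → X) (β : ℝ) : MeasurableSpace X :=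
  MeasurableSpace.generateFrom (dirKron μ T β 1)

/-- The classical Kronecker algebra of the `ℤ²`-system. -/
def kron (μ : Measure X) (T : ℤ × ℤ → X → X) : Set (Set X) :=
  {B | MeasurableSet B ∧ IsCompact (closure (korbit μ T Set.univ B))}

/-- `h^{v,*}_μ(α)`: supremum of directional sequence entropies of `α` over all
infinite subsets of the strip (width `1`, immaterial). -/
def hStar (μ : Measure X) (T : ℤ × ℤ → X → X) (β : ℝ) (α : Finset (Set X)) : ℝ :=
  ⨆ w : {w : ℕ → ℤ × ℤ // EnumIn w (Lam β 1)}, seqEnt μ T w.1 α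

/-- The two-element partition `{B, Bᶜ}`. -/
def pairPart (B : Set X) : Finset (Set X) := {B, Bᶜ}

/-- The pulled-back partition `T^{-g} α = {T_g⁻¹ A : A ∈ α}`. -/
def pullPart (T : G → X → X) (g : G) (α : Finset (Set X)) : Finset (Set X) :=
  α.image fun A => T g ⁻¹' A

end

section WeakLimits

variable {H : Type*} [NormedAddCommGroup H] [InnerProductSpace ℝ H] [CompleteSpace H]

/-- A bounded family in a Hilbert space converges weakly along every ultrafilter. -/
lemma exists_weak_limit {ι : Type*} (p : Ultrafilter ι) (x : ι → H) (C : ℝ)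
    (hx : ∀ i, ‖x i‖ ≤ C) :
    ∃ y : H, ∀ g : H, Tendsto (fun i => inner ℝ (x i) g) p (𝓝 (inner ℝ y g)) := by
  have hbd : ∀ (g : H) i, |inner ℝ (x i) g| ≤ C * ‖g‖ := fun g i =>
    (abs_real_inner_le_norm _ _).trans (mul_le_mul_of_nonneg_right (hx i) (norm_nonneg _))
  have hex : ∀ g : H, ∃ l : ℝ, Tendsto (fun i => inner ℝ (x i) g) p (𝓝 l) := by
    intro g
    have hmem : ((p.map fun i => inner ℝ (x i) g : Ultrafilter ℝ) : Filter ℝ)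
        ≤ 𝓟 (Icc (-(C * ‖g‖)) (C * ‖g‖)) := by
      rw [Filter.le_principal_iff]
      exact Filter.mem_map.2 (Filter.univ_mem' fun i => abs_le.1 (hbd g i))
    obtain ⟨l, -, hl⟩ := isCompact_Icc.ultrafilter_le_nhds _ hmem
    exact ⟨l, hl⟩
  choose L hL using hex
  let L' : H →ₗ[ℝ] ℝ :=
    { toFun := L
      map_add' := fun a c => tendsto_nhds_unique (hL (a + c))
        (((hL a).add (hL c)).congr fun i => (inner_add_right _ _ _).symm)
      map_smul' := fun r a => tendsto_nhds_unique (hL (r • a))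
        (((hL a).const_mul r).congr fun i => (real_inner_smul_right _ _ _).symm) }
  have hL' : ∀ g, ‖L' g‖ ≤ C * ‖g‖ := fun g =>
    le_of_tendsto (hL g).norm (Filter.univ_mem' fun i => hbd g i)
  refine ⟨(InnerProductSpace.toDual ℝ H).symm (L'.mkContinuous C hL'), fun g => ?_⟩
  rw [InnerProductSpace.toDual_symm_apply]
  exact hL g

/-- The weak limit of `U w f` along an ultrafilter. -/
noncomputable def weakLim {G : Type*} (U : G → H →ₗᵢ[ℝ] H) (p : Ultrafilter G) (f : H) : H :=
  (exists_weak_limit p (fun w => U w f) ‖f‖ fun w => (U w).norm_map f |>.le).choose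

variable {G : Type*} {U : G → H →ₗᵢ[ℝ] H}

lemma tendsto_inner_weakLim (p : Ultrafilter G) (f g : H) :
    Tendsto (fun w => inner ℝ (U w f) g) p (𝓝 (inner ℝ (weakLim U p f) g)) :=
  (exists_weak_limit p (fun w => U w f) ‖f‖ fun w => (U w).norm_map f |>.le).choose_spec g

lemma norm_weakLim_le (p : Ultrafilter G) (f : H) : ‖weakLim U p f‖ ≤ ‖f‖ := by
  by_contra! h
  have h0 : 0 < ‖weakLim U p f‖ := (norm_nonneg _).trans_lt h
  have := le_of_tendsto (tendsto_inner_weakLim (U := U) p f (weakLim U p f))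
    (Filter.univ_mem' fun w => (real_inner_le_norm _ _).trans_eq (by rw [(U w).norm_map]))
  rw [real_inner_self_eq_norm_mul_norm] at this
  exact absurd (le_of_mul_le_mul_right this h0) h.not_ge

lemma eq_of_tendsto_bind {ι κ : Type*} (p : Ultrafilter ι) (q : Ultrafilter κ)
    (φ : ι → κ → G) {F : G → ℝ} {a b : ℝ} {c : ι → ℝ}
    (hF : Tendsto F (p.bind fun i => q.map (φ i) : Ultrafilter G) (𝓝 a))
    (hc : ∀ i, Tendsto (fun j => F (φ i j)) q (𝓝 (c i))) (hb : Tendsto c p (𝓝 b)) : a = b := by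
  refine tendsto_nhds_unique (f := c) (l := p) ?_ hb
  rw [(closed_nhds_basis a).tendsto_right_iff]
  rintro V ⟨hV, hVc⟩
  have h1 : ∀ᶠ i in (p : Filter ι), ∀ᶠ j in (q : Filter κ), F (φ i j) ∈ V := hF hV
  filter_upwards [h1] with i hi
  exact hVc.mem_of_tendsto (hc i) hi

lemma lowerSemicontinuous_norm_weakLim (f : H) :
    LowerSemicontinuous fun p : Ultrafilter G => ‖weakLim U p f‖ := by
  intro p c hc
  rcases lt_or_ge c 0 with h0 | h0
  · exact Filter.Eventually.of_forall fun q => h0.trans_le (norm_nonneg _)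
  set y := weakLim U p f with hy
  have hy0 : 0 < ‖y‖ := h0.trans_lt hc
  obtain ⟨d, hcd, hd⟩ := exists_between (mul_lt_mul_of_pos_right hc hy0)
  have h1 : ∀ᶠ w in (p : Filter G), d < inner ℝ (U w f) y :=
    (tendsto_inner_weakLim p f y).eventually_const_lt
      (by rwa [← hy, real_inner_self_eq_norm_mul_norm])
  filter_upwards [(ultrafilter_isOpen_basic {w | d < inner ℝ (U w f) y}).mem_nhds h1] with q hq
  have h2 : d ≤ inner ℝ (weakLim U q f) y :=
    ge_of_tendsto (tendsto_inner_weakLim q f y) (Filter.mem_of_superset hq fun w (hw : d < _) => hw.le)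
  exact lt_of_mul_lt_mul_right (hcd.trans_le (h2.trans (real_inner_le_norm _ _))) hy0.le

end WeakLimits

section Strip

/-- Lattice points in the strip of width `1 / (N + 1)` with first coordinate at least `N`. -/
def thinStrip (β : ℝ) (N : ℕ) : Set (ℤ × ℤ) :=
  {w | |(w.2 : ℝ) - β * w.1| ≤ 1 / (N + 1) ∧ (N : ℤ) ≤ w.1}

lemma thinStrip_anti (β : ℝ) : Antitone (thinStrip β) := by
  intro M N h w hw
  refine ⟨hw.1.trans (one_div_le_one_div_of_le (by positivity) (by exact_mod_cast by omega)), ?_⟩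
  exact le_trans (by exact_mod_cast h) hw.2

lemma thinStrip_nonempty (β : ℝ) (N : ℕ) : (thinStrip β N).Nonempty := by
  obtain ⟨j, k, hk, -, h⟩ :=
    Real.exists_int_int_abs_mul_sub_le (((N + 1 : ℕ) : ℝ) * β) (Nat.succ_pos N)
  refine ⟨(k * (N + 1 : ℕ), j), ?_, ?_⟩
  · rw [abs_sub_comm]
    have h2 : (1 : ℝ) / (((N + 1 : ℕ) : ℝ) + 1) ≤ 1 / (N + 1) :=
      one_div_le_one_div_of_le (by positivity) (by push_cast; linarith)
    refine le_trans (le_of_eq ?_) (h.trans h2)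
    push_cast
    ring_nf
  · push_cast
    nlinarith

lemma thinStrip_subset_Lam (β : ℝ) {b : ℝ} (hb : 0 < b) : ∃ N, thinStrip β N ⊆ Lam β b := by
  obtain ⟨N, hN⟩ := exists_nat_one_div_lt (half_pos hb)
  refine ⟨N, fun w hw => ?_⟩
  have := abs_le.1 (hw.1.trans hN.le)
  constructor <;> linarith

/-- Ultrafilters that converge to infinity along the direction `(1, β)`. -/
def dirUltra (β : ℝ) : Set (Ultrafilter (ℤ × ℤ)) :=
  {p | ∀ N, thinStrip β N ∈ p}

lemma isCompact_dirUltra (β : ℝ) : IsCompact (dirUltra β) := by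
  refine IsClosed.isCompact ?_
  have : dirUltra β = ⋂ N, {p : Ultrafilter (ℤ × ℤ) | thinStrip β N ∈ p} := by
    ext p; simp [dirUltra]
  rw [this]
  exact isClosed_iInter fun N => ultrafilter_isClosed_basic _

lemma dirUltra_nonempty (β : ℝ) : (dirUltra β).Nonempty := by
  have : (⨅ N, 𝓟 (thinStrip β N)).NeBot := by
    refine Filter.iInf_neBot_of_directed' ?_ fun N =>
      Filter.principal_neBot_iff.2 (thinStrip_nonempty β N)
    exact (Filter.monotone_principal.comp_antitone (thinStrip_anti β)).directed_ge
  refine ⟨Ultrafilter.of (⨅ N, 𝓟 (thinStrip β N)), fun N => ?_⟩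
  exact Ultrafilter.of_le _ (Filter.mem_iInf_of_mem N (Filter.mem_principal_self _))

lemma bind_mem_dirUltra {β : ℝ} {p q : Ultrafilter (ℤ × ℤ)} (hp : p ∈ dirUltra β)
    (hq : q ∈ dirUltra β) : (p.bind fun v => q.map fun w => v + w) ∈ dirUltra β := by
  intro N
  have key : ∀ᶠ v in (p : Filter (ℤ × ℤ)), ∀ᶠ w in (q : Filter (ℤ × ℤ)),
      v + w ∈ thinStrip β N := by
    filter_upwards [hp (2 * N + 1)] with v hv
    filter_upwards [hq (2 * N + 1)] with w hw
    have e : (1 : ℝ) / (((2 * N + 1 : ℕ) : ℝ) + 1) = 1 / (N + 1) / 2 := by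
      push_cast; field_simp; ring
    have h1 := hv.1
    have h2 := hw.1
    rw [e] at h1 h2
    refine ⟨?_, ?_⟩
    · have e2 : (((v + w).2 : ℤ) : ℝ) - β * ((v + w).1 : ℤ)
          = ((v.2 : ℝ) - β * v.1) + ((w.2 : ℝ) - β * w.1) := by
        simp only [Prod.fst_add, Prod.snd_add]; push_cast; ring
      rw [e2]
      exact (abs_add_le _ _).trans (by linarith)
    · have := hv.2
      have := hw.2
      simp only [Prod.fst_add]
      push_cast at *
      linarith
  exact key

lemma ultrafilter_dichotomy (q : Ultrafilter (ℤ × ℤ)) {β : ℝ} (hq : Lam β 1 ∈ q) :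
    (∃ w, q = pure w) ∨
    (q.bind fun v => q.map fun w => w - v) ∈ dirUltra β ∨
    (q.bind fun v => q.map fun w => v - w) ∈ dirUltra β := by
  have hs : ∀ ε > 0, ∀ᶠ v : ℤ × ℤ in (q : Filter (ℤ × ℤ)), ∀ᶠ w in (q : Filter (ℤ × ℤ)),
      |((w.2 : ℝ) - β * w.1) - ((v.2 : ℝ) - β * v.1)| ≤ ε := by
    intro ε hε
    have hmem : ((q.map fun w => (w.2 : ℝ) - β * w.1 : Ultrafilter ℝ) : Filter ℝ)
        ≤ 𝓟 (Icc (-(1 / 2)) (1 / 2)) := by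
      rw [Filter.le_principal_iff]
      refine Filter.mem_map.2 (Filter.mem_of_superset hq fun w hw => ?_)
      exact ⟨by linarith [hw.1], by linarith [hw.2]⟩
    obtain ⟨l, -, hl⟩ := isCompact_Icc.ultrafilter_le_nhds _ hmem
    have hl' : ∀ᶠ w : ℤ × ℤ in (q : Filter (ℤ × ℤ)), |((w.2 : ℝ) - β * w.1) - l| < ε / 2 :=
      hl (Metric.ball_mem_nhds l (half_pos hε))
    filter_upwards [hl'] with v hv
    filter_upwards [hl'] with w hw
    have := abs_lt.1 hv
    have := abs_lt.1 hw
    exact abs_le.2 ⟨by linarith, by linarith⟩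
  by_cases hplus : ∀ N : ℤ, ∀ᶠ w : ℤ × ℤ in (q : Filter (ℤ × ℤ)), N ≤ w.1
  · refine Or.inr (Or.inl fun N => ?_)
    have key : ∀ᶠ v in (q : Filter (ℤ × ℤ)), ∀ᶠ w in (q : Filter (ℤ × ℤ)),
        w - v ∈ thinStrip β N := by
      filter_upwards [hs (1 / (N + 1)) (by positivity)] with v hv
      filter_upwards [hv, hplus (v.1 + N)] with w h1 h2
      refine ⟨le_trans (le_of_eq ?_) h1, by simp only [Prod.fst_sub]; linarith⟩
      simp only [Prod.fst_sub, Prod.snd_sub]; push_cast; ring_nf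
    exact key
  by_cases hminus : ∀ N : ℤ, ∀ᶠ w : ℤ × ℤ in (q : Filter (ℤ × ℤ)), w.1 ≤ N
  · refine Or.inr (Or.inr fun N => ?_)
    have key : ∀ᶠ v in (q : Filter (ℤ × ℤ)), ∀ᶠ w in (q : Filter (ℤ × ℤ)),
        v - w ∈ thinStrip β N := by
      filter_upwards [hs (1 / (N + 1)) (by positivity)] with v hv
      filter_upwards [hv, hminus (v.1 - N)] with w h1 h2
      refine ⟨le_trans (le_of_eq ?_) h1, by simp only [Prod.fst_sub]; linarith⟩
      rw [abs_sub_comm]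
      simp only [Prod.fst_sub, Prod.snd_sub]; push_cast; ring_nf
    exact key
  left
  push Not at hplus hminus
  obtain ⟨M, hM⟩ := hplus
  obtain ⟨N, hN⟩ := hminus
  obtain ⟨K, hK⟩ := exists_nat_gt (|β| * (|(M : ℝ)| + |(N : ℝ)|) + 1)
  have hfin : (Icc N M ×ˢ Icc (-(K : ℤ)) K).Finite := (finite_Icc _ _).prod (finite_Icc _ _)
  have hmem : Icc N M ×ˢ Icc (-(K : ℤ)) K ∈ q := by
    filter_upwards [hM, hN, hq] with w h1 h2 h3
    refine ⟨⟨h2.le, h1.le⟩, ?_⟩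
    have h4 : |(w.1 : ℝ)| ≤ |(M : ℝ)| + |(N : ℝ)| := by
      have a1 : (w.1 : ℝ) ≤ M := by exact_mod_cast h1.le
      have a2 : (N : ℝ) ≤ w.1 := by exact_mod_cast h2.le
      refine abs_le.2 ⟨?_, ?_⟩
      · linarith [neg_abs_le (N : ℝ), abs_nonneg (M : ℝ)]
      · linarith [le_abs_self (M : ℝ), abs_nonneg (N : ℝ)]
    have h5 : |β * w.1| ≤ |β| * (|(M : ℝ)| + |(N : ℝ)|) := by
      rw [abs_mul]; exact mul_le_mul_of_nonneg_left h4 (abs_nonneg _)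
    have h6 := abs_le.1 h5
    have h7 := h3.1
    have h8 := h3.2
    constructor
    · have : (-(K : ℝ)) ≤ w.2 := by linarith
      exact_mod_cast this
    · have : (w.2 : ℝ) ≤ K := by linarith
      exact_mod_cast this
  obtain ⟨w, -, hw⟩ := Ultrafilter.eq_pure_of_finite_mem hfin hmem
  exact ⟨w, hw⟩

end Strip

section StripCompact

variable {H : Type*} [NormedAddCommGroup H] [InnerProductSpace ℝ H]

/-- The orbit of `h` along the strip of width `1` is totally bounded. -/
def StripCompact (U : ℤ × ℤ → H →ₗᵢ[ℝ] H) (β : ℝ) (h : H) : Prop :=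
  TotallyBounded ((fun w => U w h) '' Lam β 1)

variable {U : ℤ × ℤ → H →ₗᵢ[ℝ] H} {β : ℝ}

lemma StripCompact.apply (hadd : ∀ v w f, U (v + w) f = U v (U w f)) {h : H}
    (hh : StripCompact U β h) (v : ℤ × ℤ) : StripCompact U β (U v h) := by
  have := TotallyBounded.image hh (U v).isometry.uniformContinuous
  rw [image_image] at this
  refine this.subset (le_of_eq ?_)
  refine image_congr fun w _ => ?_
  rw [← hadd, ← hadd, add_comm]

lemma inner_apply_left (hadd : ∀ v w f, U (v + w) f = U v (U w f)) (hzero : ∀ f, U 0 f = f)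
    (w : ℤ × ℤ) (f g : H) : inner ℝ (U w f) g = inner ℝ f (U (-w) g) := by
  rw [← (U w).inner_map_map f, ← hadd, add_neg_cancel, hzero]

lemma stripCompact_of_approx {h : H}
    (hh : ∀ ε > 0, ∃ g, StripCompact U β g ∧ ‖g - h‖ < ε) : StripCompact U β h := by
  rw [StripCompact, Metric.totallyBounded_iff]
  intro ε hε
  obtain ⟨g, hg, hgh⟩ := hh (ε / 2) (half_pos hε)
  obtain ⟨t, ht, hsub⟩ := Metric.totallyBounded_iff.1 hg (ε / 2) (half_pos hε)
  refine ⟨t, ht, ?_⟩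
  rintro _ ⟨w, hw, rfl⟩
  obtain ⟨y, hy, hyw⟩ := mem_iUnion₂.1 (hsub ⟨w, hw, rfl⟩)
  refine mem_iUnion₂.2 ⟨y, hy, ?_⟩
  have h1 : dist (U w h) (U w g) < ε / 2 := by
    rw [(U w).isometry.dist_eq, dist_comm, dist_eq_norm]; exact hgh
  have h2 : dist (U w g) y < ε / 2 := hyw
  exact Metric.mem_ball.2 ((dist_triangle _ _ _).trans_lt (by linarith))

variable [CompleteSpace H]

lemma weakLim_bind_add (hadd : ∀ v w f, U (v + w) f = U v (U w f)) (hzero : ∀ f, U 0 f = f)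
    (p q : Ultrafilter (ℤ × ℤ)) (f : H) :
    weakLim U (p.bind fun v => q.map fun w => v + w) f = weakLim U p (weakLim U q f) := by
  refine ext_inner_right ℝ fun g => ?_
  refine eq_of_tendsto_bind p q (fun v w => v + w) (tendsto_inner_weakLim _ f g)
    (c := fun v => inner ℝ (U v (weakLim U q f)) g) (fun v => ?_) (tendsto_inner_weakLim _ _ g)
  simp only [hadd, inner_apply_left hadd hzero v]
  exact tendsto_inner_weakLim q f _

lemma norm_weakLim_eq (hadd : ∀ v w f, U (v + w) f = U v (U w f)) (hzero : ∀ f, U 0 f = f)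
    {h : H} {r q : Ultrafilter (ℤ × ℤ)} (hr : ‖weakLim U r h‖ = ‖h‖)
    (hrq : (r = q.bind fun v => q.map fun w => w - v) ∨
      r = q.bind fun v => q.map fun w => v - w) : ‖weakLim U q h‖ = ‖h‖ := by
  have key : ∀ g, inner ℝ (weakLim U r h) g = inner ℝ (weakLim U q h) (weakLim U q g) := by
    intro g
    rcases hrq with rfl | rfl
    · refine eq_of_tendsto_bind q q (fun v w => w - v) (tendsto_inner_weakLim _ h g)
        (c := fun v => inner ℝ (weakLim U q h) (U v g)) (fun v => ?_) ?_
      · refine (tendsto_inner_weakLim q h (U v g)).congr fun w => ?_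
        rw [sub_eq_neg_add, hadd, inner_apply_left hadd hzero (-v), neg_neg]
      · simp only [real_inner_comm _ (weakLim U q h)]
        exact tendsto_inner_weakLim q g (weakLim U q h)
    · refine eq_of_tendsto_bind q q (fun v w => v - w) (tendsto_inner_weakLim _ h g)
        (c := fun v => inner ℝ (U v h) (weakLim U q g)) (fun v => ?_)
        (tendsto_inner_weakLim q h _)
      simp only [real_inner_comm _ (U v h)]
      refine (tendsto_inner_weakLim q g (U v h)).congr fun w => ?_
      rw [real_inner_comm, sub_eq_neg_add, hadd, inner_apply_left hadd hzero (-w), neg_neg]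
  refine le_antisymm (norm_weakLim_le _ _) ?_
  rcases (norm_nonneg h).eq_or_lt with h0 | h0
  · rw [← h0]; exact norm_nonneg _
  have h1 := key (weakLim U r h)
  rw [real_inner_self_eq_norm_mul_norm, hr] at h1
  have h2 : ‖h‖ * ‖h‖ ≤ ‖weakLim U q h‖ * ‖h‖ := by
    rw [h1]
    refine (real_inner_le_norm _ _).trans (mul_le_mul_of_nonneg_left ?_ (norm_nonneg _))
    exact (norm_weakLim_le _ _).trans hr.le
  exact le_of_mul_le_mul_right h2 h0

lemma stripCompact_of_norm_weakLim (hadd : ∀ v w f, U (v + w) f = U v (U w f))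
    (hzero : ∀ f, U 0 f = f) {h : H} (hh : ∀ p ∈ dirUltra β, ‖weakLim U p h‖ = ‖h‖) :
    StripCompact U β h := by
  rw [StripCompact, totallyBounded_iff_ultrafilter]
  intro F hF
  have hmem : (fun w => U w h) '' Lam β 1 ∈ F := Filter.le_principal_iff.1 hF
  obtain ⟨q, hq, rfl⟩ : ∃ q : Ultrafilter (ℤ × ℤ), Lam β 1 ∈ q ∧ q.map (fun w => U w h) = F :=
    ⟨_, Ultrafilter.ofComapInfPrincipal_mem hmem, Ultrafilter.ofComapInfPrincipal_eq_of_map hmem⟩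
  suffices hlim : ∃ y, Tendsto (fun w => U w h) q (𝓝 y) by
    obtain ⟨y, hy⟩ := hlim
    exact cauchy_nhds.mono hy
  rcases ultrafilter_dichotomy q hq with ⟨w, rfl⟩ | hr
  · exact ⟨U w h, tendsto_pure_nhds _ _⟩
  have hQ : ‖weakLim U q h‖ = ‖h‖ := by
    rcases hr with hr | hr
    · exact norm_weakLim_eq hadd hzero (hh _ hr) (Or.inl rfl)
    · exact norm_weakLim_eq hadd hzero (hh _ hr) (Or.inr rfl)
  refine ⟨weakLim U q h, tendsto_iff_norm_sub_tendsto_zero.2 ?_⟩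
  have h1 := (tendsto_inner_weakLim (U := U) q h (weakLim U q h)).const_mul 2
  have h2 := (h1.const_sub (‖h‖ ^ 2)).add_const (‖weakLim U q h‖ ^ 2)
  have h3 := h2.sqrt
  rw [real_inner_self_eq_norm_sq, hQ] at h3
  have e : √(‖h‖ ^ 2 - 2 * ‖h‖ ^ 2 + ‖h‖ ^ 2) = 0 := by rw [← Real.sqrt_zero]; congr 1; ring
  rw [e] at h3
  refine h3.congr fun w => ?_
  rw [← Real.sqrt_sq (norm_nonneg (U w h - _)), norm_sub_sq_real, (U w).norm_map, hQ]

/-- Vectors orthogonal to all strip-compact vectors converge weakly to `0`, simultaneously,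
along some ultrafilter in the direction `(1, β)`. -/
lemma exists_dirUltra_weakLim_eq_zero (hadd : ∀ v w f, U (v + w) f = U v (U w f))
    (hzero : ∀ f, U 0 f = f) {ι : Type*} (s : Finset ι) (f : ι → H)
    (hf : ∀ i ∈ s, ∀ h, StripCompact U β h → inner ℝ (f i) h = 0) :
    ∃ p ∈ dirUltra β, ∀ i ∈ s, weakLim U p (f i) = 0 := by
  have hlsc : LowerSemicontinuous fun p : Ultrafilter (ℤ × ℤ) => ∑ i ∈ s, ‖weakLim U p (f i)‖ :=
    lowerSemicontinuous_sum fun i _ => lowerSemicontinuous_norm_weakLim (f i)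
  obtain ⟨p, hp, hmin⟩ := (hlsc.lowerSemicontinuousOn _).exists_isMinOn
    (dirUltra_nonempty β) (isCompact_dirUltra β)
  refine ⟨p, hp, fun i hi => ?_⟩
  have hnorm : ∀ q ∈ dirUltra β, ‖weakLim U q (weakLim U p (f i))‖ = ‖weakLim U p (f i)‖ := by
    intro q hq
    have h1 := hmin (bind_mem_dirUltra hq hp)
    simp only [mem_ofPred_eq, weakLim_bind_add hadd hzero] at h1
    exact (Finset.sum_eq_sum_iff_of_le fun j _ => norm_weakLim_le q _).1
      (le_antisymm (Finset.sum_le_sum fun j _ => norm_weakLim_le q _) h1) i hi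
  have hc := stripCompact_of_norm_weakLim hadd hzero hnorm
  have hlim := tendsto_inner_weakLim (U := U) p (f i) (weakLim U p (f i))
  have hz : ∀ w, inner ℝ (U w (f i)) (weakLim U p (f i)) = 0 := fun w => by
    rw [inner_apply_left hadd hzero]
    exact hf i hi _ (hc.apply hadd _)
  simp only [hz] at hlim
  exact inner_self_eq_zero.1 (tendsto_nhds_unique hlim tendsto_const_nhds)

end StripCompact

section Koopman

lemma dirKronAlg_le {X : Type*} {m : MeasurableSpace X} {μ : Measure X} {T : ℤ × ℤ → X → X}
    {β : ℝ} : dirKronAlg μ T β ≤ m :=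
  MeasurableSpace.generateFrom_le fun _ hB => hB.1

variable {X : Type*} [MeasurableSpace X] {μ : Measure X} {T : ℤ × ℤ → X → X}

/-- The Koopman isometries on `L²(μ)`. -/
noncomputable def koopman (hT : ∀ w, MeasurePreserving (T w) μ μ) (w : ℤ × ℤ) :
    Lp ℝ 2 μ →ₗᵢ[ℝ] Lp ℝ 2 μ :=
  Lp.compMeasurePreservingₗᵢ ℝ (T w) (hT w)

variable (hT : ∀ w, MeasurePreserving (T w) μ μ)

lemma coeFn_koopman (w : ℤ × ℤ) (f : Lp ℝ 2 μ) : koopman hT w f =ᵐ[μ] f ∘ T w :=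
  Lp.coeFn_compMeasurePreserving f (hT w)

lemma koopman_add (hadd : ∀ v w, T (v + w) = T v ∘ T w) (v w : ℤ × ℤ) (f : Lp ℝ 2 μ) :
    koopman hT (v + w) f = koopman hT v (koopman hT w f) := by
  refine Lp.ext ?_
  have h1 := (hT v).quasiMeasurePreserving.ae_eq_comp (coeFn_koopman hT w f)
  refine (coeFn_koopman hT (v + w) f).trans (((coeFn_koopman hT v _).trans h1).trans ?_).symm
  rw [add_comm, hadd, Function.comp_assoc]

lemma koopman_zero (hzero : T 0 = _root_.id) (f : Lp ℝ 2 μ) : koopman hT 0 f = f := by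
  refine Lp.ext ((coeFn_koopman hT 0 f).trans ?_)
  rw [hzero, Function.comp_id]

lemma coeFn_koopman_eq (w : ℤ × ℤ) {f : Lp ℝ 2 μ} {g : X → ℝ} (hfg : f =ᵐ[μ] g) :
    koopman hT w f =ᵐ[μ] g ∘ T w :=
  (coeFn_koopman hT w f).trans ((hT w).quasiMeasurePreserving.ae_eq_comp hfg)

variable {β : ℝ}

lemma StripCompact.compLp {h : Lp ℝ 2 μ} (hh : StripCompact (koopman hT) β h) {φ : ℝ → ℝ}
    {c : NNReal} (hφ : LipschitzWith c φ) (hφ0 : φ 0 = 0) :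
    StripCompact (koopman hT) β (hφ.compLp hφ0 h) := by
  have := TotallyBounded.image hh (hφ.lipschitzWith_compLp hφ0).uniformContinuous
  rw [image_image] at this
  refine this.subset (le_of_eq (image_congr fun w _ => Lp.ext ?_))
  refine (coeFn_koopman_eq hT w (hφ.coeFn_compLp hφ0 h)).trans ?_
  filter_upwards [hφ.coeFn_compLp hφ0 (koopman hT w h), coeFn_koopman hT w h] with x h1 h2
  rw [h1]
  simp only [Function.comp_apply] at h2 ⊢
  rw [h2]

lemma StripCompact.neg {h : Lp ℝ 2 μ} (hh : StripCompact (koopman hT) β h) :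
    StripCompact (koopman hT) β (-h) := by
  have := TotallyBounded.image hh (uniformContinuous_neg (α := Lp ℝ 2 μ))
  rw [image_image] at this
  simpa [StripCompact] using this

variable [IsProbabilityMeasure μ]

lemma mem_dirKron_of_stripCompact {B : Set X} (hB : MeasurableSet B)
    (h : StripCompact (koopman hT) β (indicatorConstLp 2 hB (measure_ne_top μ B) (1 : ℝ))) :
    B ∈ dirKron μ T β 1 := by
  refine ⟨hB, isCompact_iff_totallyBounded_isComplete.2
    ⟨TotallyBounded.closure (h.subset ?_), isClosed_closure.isComplete⟩⟩
  rintro g ⟨w, hw, hg⟩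
  refine ⟨w, hw, Lp.ext ?_⟩
  exact (coeFn_koopman_eq hT w indicatorConstLp_coeFn).trans hg.symm

/-- The ramp `t ↦ min 1 (n (t - c)⁺)`. -/
noncomputable def ramp (n : ℕ) (c t : ℝ) : ℝ := min 1 (n * max (t - c) 0)

lemma lipschitzWith_ramp (n : ℕ) (c : ℝ) : LipschitzWith n (ramp n c) := by
  have h1 : LipschitzWith 1 fun t : ℝ => max (t - c) 0 :=
    (LipschitzWith.of_dist_le_mul fun x y => by simp).max_const 0
  have h2 : LipschitzWith n fun t : ℝ => (n : ℝ) * max (t - c) 0 := by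
    refine LipschitzWith.of_dist_le_mul fun x y => ?_
    rw [Real.dist_eq, ← mul_sub, abs_mul, Nat.abs_cast, ← Real.dist_eq]
    refine mul_le_mul_of_nonneg_left ((h1.dist_le_mul x y).trans_eq (by simp)) (by positivity)
  exact h2.const_min 1

lemma tendsto_ramp (c t : ℝ) :
    Tendsto (fun n => ramp n c t) atTop (𝓝 ((Ioi c).indicator (fun _ => (1 : ℝ)) t)) := by
  by_cases h : c < t
  · rw [indicator_of_mem (mem_Ioi.2 h)]
    refine tendsto_const_nhds.congr' ?_
    obtain ⟨N, hN⟩ := exists_nat_gt (1 / (t - c))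
    filter_upwards [eventually_ge_atTop N] with n hn
    have h0 : 0 < t - c := sub_pos.2 h
    rw [ramp, max_eq_left h0.le, min_eq_left]
    have : 1 / (t - c) ≤ n := hN.le.trans (by exact_mod_cast hn)
    rwa [div_le_iff₀ h0] at this
  · rw [indicator_of_notMem (by simpa using h)]
    refine tendsto_const_nhds.congr fun n => ?_
    rw [ramp, max_eq_right (by linarith)]
    simp

lemma superlevel_mem_dirKron {h : Lp ℝ 2 μ} (hh : StripCompact (koopman hT) β h) {c : ℝ}
    (hc : 0 ≤ c) : (h : X → ℝ) ⁻¹' Ioi c ∈ dirKron μ T β 1 := by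
  have hm : Measurable (h : X → ℝ) := (Lp.stronglyMeasurable h).measurable
  have hB : MeasurableSet ((h : X → ℝ) ⁻¹' Ioi c) := hm measurableSet_Ioi
  refine mem_dirKron_of_stripCompact hT hB (stripCompact_of_approx fun ε hε => ?_)
  have hr0 : ∀ n, ramp n c 0 = 0 := fun n => by
    rw [ramp, max_eq_right (by linarith)]; simp
  set F : ℕ → Lp ℝ 2 μ := fun n => (lipschitzWith_ramp n c).compLp (hr0 n) h
  set I := indicatorConstLp 2 hB (measure_ne_top μ _) (1 : ℝ)
  have hbound : ∀ n t, 0 ≤ ramp n c t ∧ ramp n c t ≤ 1 := fun n t =>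
    ⟨le_min zero_le_one (by positivity), min_le_left _ _⟩
  have hnorm : ∀ n, ‖F n - I‖ ^ 2
      = ∫ x, (ramp n c (h x) - (Ioi c).indicator (fun _ => (1 : ℝ)) (h x)) ^ 2 ∂μ := by
    intro n
    rw [← real_inner_self_eq_norm_sq, L2.inner_def]
    refine integral_congr_ae ?_
    filter_upwards [Lp.coeFn_sub (F n) I, (lipschitzWith_ramp n c).coeFn_compLp (hr0 n) h,
      indicatorConstLp_coeFn (p := 2) (hs := hB) (hμs := measure_ne_top μ _) (c := (1 : ℝ))]
      with x h1 h2 h3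
    have h4 : F n x = ramp n c (h x) := h2
    have h5 : I x = (Ioi c).indicator (fun _ => (1 : ℝ)) (h x) := h3
    rw [h1, Pi.sub_apply, h4, h5, real_inner_self_eq_norm_sq, Real.norm_eq_abs, sq_abs]
  have hlim : Tendsto (fun n => ‖F n - I‖ ^ 2) atTop (𝓝 (∫ _, (0 : ℝ) ∂μ)) := by
    simp only [hnorm]
    refine tendsto_integral_of_dominated_convergence (fun _ => 1) (fun n => ?_)
      (integrable_const _) (fun n => Filter.Eventually.of_forall fun x => ?_)
      (Filter.Eventually.of_forall fun x => ?_)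
    · have h1 : Measurable fun x => ramp n c (h x) :=
        (lipschitzWith_ramp n c).continuous.measurable.comp hm
      have h2 : Measurable fun x => (Ioi c).indicator (fun _ => (1 : ℝ)) (h x) :=
        (measurable_const.indicator measurableSet_Ioi).comp hm
      exact ((h1.sub h2).pow_const 2).aestronglyMeasurable
    · have h1 := hbound n (h x)
      rw [Real.norm_eq_abs, abs_pow, sq_le_one_iff₀ (abs_nonneg _)]
      by_cases hx : h x ∈ Ioi c
      · rw [indicator_of_mem hx]; exact abs_le.2 ⟨by linarith, by linarith⟩
      · rw [indicator_of_notMem hx]; exact abs_le.2 ⟨by linarith, by linarith⟩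
    · simpa using ((tendsto_ramp c (h x)).sub_const
        ((Ioi c).indicator (fun _ => (1 : ℝ)) (h x))).pow 2
  rw [integral_zero] at hlim
  obtain ⟨n, hn⟩ := (hlim.eventually_lt_const (pow_pos hε 2)).exists
  exact ⟨F n, hh.compLp hT _ _, lt_of_pow_lt_pow_left₀ 2 hε.le hn⟩

lemma measurable_posPart_of_stripCompact {h : Lp ℝ 2 μ} (hh : StripCompact (koopman hT) β h) :
    Measurable[dirKronAlg μ T β] fun x => max (h x) 0 := by
  refine @measurable_of_Ioi _ _ _ _ _ (dirKronAlg μ T β) _ _ _ _ fun c => ?_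
  rcases lt_or_ge c 0 with hc | hc
  · convert @MeasurableSet.univ _ (dirKronAlg μ T β)
    exact eq_univ_of_forall fun x => hc.trans_le (le_max_right _ _)
  · refine MeasurableSpace.measurableSet_generateFrom ?_
    convert superlevel_mem_dirKron hT hh hc using 1
    ext x
    simp [not_lt.2 hc]

/-- Strip-compact functions are measurable with respect to the directional Kronecker algebra. -/
lemma exists_measurable_of_stripCompact {h : Lp ℝ 2 μ} (hh : StripCompact (koopman hT) β h) :
    ∃ g : X → ℝ, Measurable[dirKronAlg μ T β] g ∧ h =ᵐ[μ] g := by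
  refine ⟨fun x => max (h x) 0 - max ((-h : Lp ℝ 2 μ) x) 0, ?_, ?_⟩
  · exact (measurable_posPart_of_stripCompact hT hh).sub
      (measurable_posPart_of_stripCompact hT (hh.neg hT))
  · filter_upwards [Lp.coeFn_neg h] with x hx
    rw [hx, Pi.neg_apply]
    rcases le_total (h x) 0 with h0 | h0
    · rw [max_eq_right h0, max_eq_left (by linarith)]; ring
    · rw [max_eq_left h0, max_eq_right (by linarith)]; ring

/-- The deviation of `1_A` from its conditional expectation is orthogonal to all strip-compact
functions. -/
lemma integral_sub_condExp_mul_eq_zero {A : Set X} (hA : MeasurableSet A) {h : Lp ℝ 2 μ}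
    (hh : StripCompact (koopman hT) β h) :
    ∫ x, (A.indicator (fun _ => (1 : ℝ)) x
      - (μ[A.indicator (fun _ => (1 : ℝ)) | dirKronAlg μ T β]) x) * h x ∂μ = 0 := by
  obtain ⟨g, hg, hhg⟩ := exists_measurable_of_stripCompact hT hh
  set a : X → ℝ := A.indicator fun _ => (1 : ℝ)
  have ha : Integrable a μ := (integrable_const 1).indicator hA
  have hgi : Integrable g μ := ((Lp.memLp h).integrable (by norm_num)).congr hhg
  have hag : Integrable (a * g) μ := by
    have : a * g = A.indicator g := by
      ext x
      by_cases hx : x ∈ A <;> simp [a, hx]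
    rw [this]
    exact hgi.indicator hA
  have hce := condExp_mul_of_stronglyMeasurable_right (m := dirKronAlg μ T β)
    hg.stronglyMeasurable hag ha
  have hceg : Integrable (μ[a | dirKronAlg μ T β] * g) μ := integrable_condExp.congr hce
  have e : ∀ᵐ x ∂μ, (a x - (μ[a | dirKronAlg μ T β]) x) * h x
      = (a * g) x - (μ[a | dirKronAlg μ T β] * g) x := by
    filter_upwards [hhg] with x hx
    rw [hx, Pi.mul_apply, Pi.mul_apply, sub_mul]
  rw [integral_congr_ae e, integral_sub hag hceg, ← integral_congr_ae hce,
    integral_condExp dirKronAlg_le, sub_self]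

end Koopman

section Entropy

variable {X : Type*} [MeasurableSpace X] {μ : Measure X} [IsProbabilityMeasure μ]

lemma integrable_of_mem_Icc {E : X → ℝ} (hE : AEStronglyMeasurable E μ)
    (hE01 : ∀ᵐ x ∂μ, E x ∈ Icc (0 : ℝ) 1) : Integrable E μ := by
  refine Integrable.of_bound hE 1 ?_
  filter_upwards [hE01] with x hx
  rw [Real.norm_eq_abs, abs_of_nonneg hx.1]
  exact hx.2

lemma negMulLog_mem_Icc {t : ℝ} (ht : t ∈ Icc (0 : ℝ) 1) : Real.negMulLog t ∈ Icc (0 : ℝ) 1 :=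
  ⟨Real.negMulLog_nonneg ht.1 ht.2,
    (Real.negMulLog_le_one_sub_self ht.1).trans (by linarith [ht.1])⟩

lemma setIntegral_div_mem_Icc {E : X → ℝ} (hE : AEStronglyMeasurable E μ)
    (hE01 : ∀ᵐ x ∂μ, E x ∈ Icc (0 : ℝ) 1) (D : Set X) :
    (∫ x in D, E x ∂μ) / μ.real D ∈ Icc (0 : ℝ) 1 := by
  have h0 : 0 ≤ ∫ x in D, E x ∂μ :=
    integral_nonneg_of_ae (ae_restrict_of_ae (hE01.mono fun x hx => hx.1))
  refine ⟨div_nonneg h0 measureReal_nonneg, div_le_one_of_le₀ ?_ measureReal_nonneg⟩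
  have h1 : ∫ x in D, E x ∂μ ≤ ∫ _ in D, (1 : ℝ) ∂μ :=
    integral_mono_ae (integrable_of_mem_Icc hE hE01).integrableOn (integrable_const _)
      (ae_restrict_of_ae (hE01.mono fun x hx => hx.2))
  simpa using h1

/-- Jensen's inequality for the entropy function over a finite partition. -/
lemma integral_negMulLog_le_sum {η : Finset (Set X)} (hη : IsPartition η) {E : X → ℝ}
    (hE : AEStronglyMeasurable E μ) (hE01 : ∀ᵐ x ∂μ, E x ∈ Icc (0 : ℝ) 1) :
    ∫ x, Real.negMulLog (E x) ∂μ
      ≤ ∑ D ∈ η, μ.real D * Real.negMulLog ((∫ x in D, E x ∂μ) / μ.real D) := by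
  have hφ : Integrable (fun x => Real.negMulLog (E x)) μ :=
    integrable_of_mem_Icc (Real.continuous_negMulLog.comp_aestronglyMeasurable hE)
      (hE01.mono fun x hx => negMulLog_mem_Icc hx)
  have hun : ⋃ D ∈ η, D = univ := by
    rw [← hη.2.2, sUnion_eq_biUnion]; simp
  rw [← setIntegral_univ, ← hun, integral_biUnion_finset η hη.1 hη.2.1 fun D _ => hφ.integrableOn]
  refine Finset.sum_le_sum fun D _ => ?_
  by_cases hD : μ D = 0
  · rw [Measure.restrict_eq_zero.2 hD, measureReal_def, hD]
    simp
  have hD' : 0 < μ.real D := ENNReal.toReal_pos hD (measure_ne_top μ D)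
  have hJ := Real.concaveOn_negMulLog.le_map_set_average
    Real.continuous_negMulLog.continuousOn isClosed_Ici hD (measure_ne_top μ D)
    (ae_restrict_of_ae (hE01.mono fun x hx => hx.1))
    (integrable_of_mem_Icc hE hE01).integrableOn hφ.integrableOn
  rw [setAverage_eq, setAverage_eq, smul_eq_mul, smul_eq_mul, inv_mul_le_iff₀ hD',
    inv_mul_eq_div] at hJ
  exact hJ

lemma tendsto_negMulLog_sub {u v : ℕ → ℝ} (hu : ∀ i, u i ∈ Icc (0 : ℝ) 1)
    (hv : ∀ i, v i ∈ Icc (0 : ℝ) 1) (huv : Tendsto (fun i => u i - v i) atTop (𝓝 0)) :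
    Tendsto (fun i => Real.negMulLog (u i) - Real.negMulLog (v i)) atTop (𝓝 0) := by
  have huc := (isCompact_Icc (a := (0 : ℝ)) (b := 1)).uniformContinuousOn_of_continuous
    Real.continuous_negMulLog.continuousOn
  rw [Metric.tendsto_atTop] at huv ⊢
  intro ε hε
  obtain ⟨δ, hδ, h⟩ := Metric.uniformContinuousOn_iff.1 huc ε hε
  obtain ⟨N, hN⟩ := huv δ hδ
  refine ⟨N, fun n hn => ?_⟩
  have h1 := hN n hn
  rw [dist_zero_right, ← dist_eq_norm] at h1 ⊢
  exact h _ (hu n) _ (hv n) h1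

lemma condEntPart_pullPart {T : ℤ × ℤ → X → X} {w : ℤ × ℤ} (hw : Function.Surjective (T w))
    (α η : Finset (Set X)) :
    condEntPart μ (pullPart T w α) η = ∑ A ∈ α, ∑ D ∈ η,
      μ.real D * Real.negMulLog (μ.real (T w ⁻¹' A ∩ D) / μ.real D) := by
  rw [condEntPart, pullPart, Finset.sum_image hw.preimage_injective.injOn,
    ← Finset.sum_neg_distrib]
  refine Finset.sum_congr rfl fun A _ => ?_
  rw [← Finset.sum_neg_distrib]
  refine Finset.sum_congr rfl fun D _ => ?_
  simp only [← measureReal_def]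
  rcases eq_or_ne (μ.real D) 0 with hD | hD
  · have : μ.real (T w ⁻¹' A ∩ D) = 0 :=
      le_antisymm (hD ▸ measureReal_mono inter_subset_right) measureReal_nonneg
    simp [hD, this]
  · rw [Real.negMulLog]
    field_simp

end Entropy

section Main

lemma condExp_indicator_mem_Icc {X : Type*} {m m₀ : MeasurableSpace X} {μ : Measure X}
    [IsProbabilityMeasure μ] (hm : m ≤ m₀) {A : Set X} (hA : MeasurableSet A) :
    ∀ᵐ x ∂μ, (μ[A.indicator (fun _ => (1 : ℝ)) | m]) x ∈ Icc (0 : ℝ) 1 := by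
  have hi : Integrable (A.indicator fun _ => (1 : ℝ)) μ := (integrable_const 1).indicator hA
  have h0 : 0 ≤ᵐ[μ] μ[A.indicator (fun _ => (1 : ℝ)) | m] :=
    condExp_nonneg (Filter.Eventually.of_forall fun x => indicator_nonneg (by simp) x)
  have h1 := condExp_mono (m := m) hi (integrable_const (1 : ℝ)) (Filter.Eventually.of_forall
    fun x => indicator_le_self' (s := A) (f := fun _ => (1 : ℝ)) (by simp) x)
  rw [condExp_const hm] at h1
  filter_upwards [h0, h1] with x hx0 hx1
  exact ⟨hx0, hx1⟩

variable {X : Type*} [MeasurableSpace X] {μ : Measure X} [IsProbabilityMeasure μ]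

/-- Along some sequence in the strip, the sets of `α` decorrelate from those of `η` up to their
conditional expectations on the directional Kronecker algebra. -/
lemma exists_seq_tendsto_measureReal_sub {T : ℤ × ℤ → X → X}
    (hT : ∀ w, MeasurePreserving (T w) μ μ) (hzero : T 0 = _root_.id)
    (hadd : ∀ v w, T (v + w) = T v ∘ T w) (β : ℝ) {b : ℝ} (hb : 0 < b)
    {α η : Finset (Set X)} (hα : ∀ A ∈ α, MeasurableSet A) (hη : ∀ D ∈ η, MeasurableSet D) :
    ∃ w : ℕ → ℤ × ℤ, (∀ i, w i ∈ Lam β b) ∧ StrictMono (fun i => (w i).1) ∧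
      ∀ A ∈ α, ∀ D ∈ η, Tendsto (fun i => μ.real (T (w i) ⁻¹' A ∩ D)
        - ∫ x in D, (μ[A.indicator (fun _ => (1 : ℝ)) | dirKronAlg μ T β]) (T (w i) x) ∂μ)
        atTop (𝓝 0) := by
  have hmem : ∀ A ∈ α, MemLp (A.indicator (fun _ => (1 : ℝ))
      - μ[A.indicator (fun _ => (1 : ℝ)) | dirKronAlg μ T β]) 2 μ := fun A hA => by
    have := memLp_indicator_const 2 (hα A hA) (1 : ℝ) (Or.inr (measure_ne_top μ A))
    exact this.sub (this.condExp (by norm_num))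
  set f : α → Lp ℝ 2 μ := fun A => (hmem A A.2).toLp
  obtain ⟨p, hp, hp0⟩ := exists_dirUltra_weakLim_eq_zero (U := koopman hT) (β := β)
    (koopman_add hT hadd) (koopman_zero hT hzero) Finset.univ f (by
      intro A _ h hh
      rw [L2.inner_def, ← integral_sub_condExp_mul_eq_zero hT (hα A A.2) hh]
      refine integral_congr_ae ?_
      filter_upwards [(hmem A A.2).coeFn_toLp] with x hx
      rw [hx, Pi.sub_apply, real_inner_eq_re_inner, RCLike.inner_apply]
      simp [mul_comm])
  have hcorr : ∀ A (hA : A ∈ α), ∀ D ∈ η, Tendsto (fun w => μ.real (T w ⁻¹' A ∩ D)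
        - ∫ x in D, (μ[A.indicator (fun _ => (1 : ℝ)) | dirKronAlg μ T β]) (T w x) ∂μ)
        p (𝓝 0) := by
    intro A hA D hD
    have h1 := tendsto_inner_weakLim (U := koopman hT) p (f ⟨A, hA⟩)
      (indicatorConstLp 2 (hη D hD) (measure_ne_top μ D) (1 : ℝ))
    rw [hp0 _ (Finset.mem_univ _), inner_zero_left] at h1
    refine h1.congr fun w => ?_
    rw [real_inner_comm, L2.inner_indicatorConstLp_one]
    have hEi : Integrable (fun x =>
        (μ[A.indicator (fun _ => (1 : ℝ)) | dirKronAlg μ T β]) (T w x)) μ :=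
      (hT w).integrable_comp_of_integrable integrable_condExp
    have hAw : MeasurableSet (T w ⁻¹' A) := (hT w).measurable (hα A hA)
    have e : ∀ᵐ x ∂μ, koopman hT w (f ⟨A, hA⟩) x = (T w ⁻¹' A).indicator (fun _ => (1 : ℝ)) x
        - (μ[A.indicator (fun _ => (1 : ℝ)) | dirKronAlg μ T β]) (T w x) :=
      coeFn_koopman_eq hT w (hmem A hA).coeFn_toLp
    rw [integral_congr_ae (ae_restrict_of_ae e),
      integral_sub ((integrable_const _).indicator hAw) hEi.integrableOn,
      integral_indicator hAw, setIntegral_const, smul_eq_mul, mul_one,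
      measureReal_restrict_apply hAw]
  obtain ⟨N₀, hN₀⟩ := thinStrip_subset_Lam β hb
  have hex : ∀ k : ℕ, ∃ w : ℤ × ℤ, w ∈ Lam β b ∧ (k : ℤ) ≤ w.1 ∧ ∀ A ∈ α, ∀ D ∈ η,
      |μ.real (T w ⁻¹' A ∩ D)
        - ∫ x in D, (μ[A.indicator (fun _ => (1 : ℝ)) | dirKronAlg μ T β]) (T w x) ∂μ|
        < 1 / ((k : ℝ) + 1) := by
    intro k
    have hsmall : ∀ᶠ w in (p : Filter (ℤ × ℤ)), ∀ A ∈ α, ∀ D ∈ η,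
        |μ.real (T w ⁻¹' A ∩ D)
          - ∫ x in D, (μ[A.indicator (fun _ => (1 : ℝ)) | dirKronAlg μ T β]) (T w x) ∂μ|
          < 1 / ((k : ℝ) + 1) := by
      refine (Filter.eventually_all_finset α).2 fun A hA =>
        (Filter.eventually_all_finset η).2 fun D hD => ?_
      have h1 := (hcorr A hA D hD).abs
      rw [abs_zero] at h1
      exact h1.eventually_lt_const (by positivity)
    have h1 : ∀ᶠ w in (p : Filter (ℤ × ℤ)), w ∈ thinStrip β N₀ := hp N₀
    have h2 : ∀ᶠ w in (p : Filter (ℤ × ℤ)), w ∈ thinStrip β k := hp k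
    obtain ⟨w, hw1, hw2, hw3⟩ := (h1.and (h2.and hsmall)).exists
    exact ⟨w, hN₀ hw1, hw2.2, hw3⟩
  choose g hgL hgk hgs using hex
  obtain ⟨φ, hφ, hφm⟩ := strictMono_subseq_of_tendsto_atTop
    (tendsto_atTop_mono hgk tendsto_natCast_atTop_atTop)
  refine ⟨g ∘ φ, fun i => hgL _, hφm, fun A hA D hD => ?_⟩
  refine squeeze_zero_norm (fun i => (hgs (φ i) A hA D hD).le) ?_
  exact tendsto_one_div_add_atTop_nhds_zero_nat.comp hφ.tendsto_atTop

end Main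

/-- there is an infinite subset of the strip, with strictly
monotone first coordinates, along which
`liminf H_μ(T^{-(m,n)}α | η) ≥ H_μ(α | 𝒦^v_μ)`. -/
theorem exists_liminf_condEntPart_ge
    {X : Type*} [MetricSpace X] [CompactSpace X] [MeasurableSpace X] [BorelSpace X]
    (μ : Measure X) [IsProbabilityMeasure μ] (T : ℤ × ℤ → X → X)
    (hT : IsZ2MPS μ T) (β b : ℝ) (hb : 0 < b)
    (α η : Finset (Set X)) (hα : IsPartition α) (hη : IsPartition η) :
    ∃ w : ℕ → ℤ × ℤ, EnumIn w (Lam β b) ∧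
      (StrictMono (fun i => (w i).1) ∨ StrictAnti (fun i => (w i).1)) ∧
      condEntAlg μ (dirKronAlg μ T β) α ≤
        Filter.atTop.liminf (fun i => condEntPart μ (pullPart T (w i) α) η) := by
  obtain ⟨-, hzero, hadd, hmp⟩ := hT
  obtain ⟨w, hwL, hwm, hlim⟩ :=
    exists_seq_tendsto_measureReal_sub hmp hzero hadd β hb hα.1 hη.1
  have hsurj : ∀ v, Function.Surjective (T v) := fun v x =>
    ⟨T (-v) x, by rw [← Function.comp_apply (f := T v), ← hadd, add_neg_cancel, hzero]; rfl⟩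
  refine ⟨w, ⟨Function.Injective.of_comp (f := Prod.fst) hwm.injective, hwL⟩, Or.inl hwm, ?_⟩
  set E : Set X → X → ℝ := fun A => μ[A.indicator (fun _ => (1 : ℝ)) | dirKronAlg μ T β]
  have hEm : ∀ A, AEStronglyMeasurable (E A) μ := fun A => integrable_condExp.aestronglyMeasurable
  have hE01 : ∀ A ∈ α, ∀ᵐ x ∂μ, E A x ∈ Icc (0 : ℝ) 1 := fun A hA =>
    condExp_indicator_mem_Icc dirKronAlg_le (hα.1 A hA)
  have hETm : ∀ A v, AEStronglyMeasurable (fun x => E A (T v x)) μ := fun A v =>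
    (hEm A).comp_measurePreserving (hmp v)
  have hET01 : ∀ A ∈ α, ∀ v, ∀ᵐ x ∂μ, E A (T v x) ∈ Icc (0 : ℝ) 1 := fun A hA v =>
    (hmp v).quasiMeasurePreserving.ae (hE01 A hA)
  set u : Set X → Set X → ℕ → ℝ := fun A D i => μ.real (T (w i) ⁻¹' A ∩ D) / μ.real D
  set v : Set X → Set X → ℕ → ℝ := fun A D i => (∫ x in D, E A (T (w i) x) ∂μ) / μ.real D
  have hu : ∀ A D i, u A D i ∈ Icc (0 : ℝ) 1 := fun A D i =>
    ⟨by positivity, div_le_one_of_le₀ (measureReal_mono inter_subset_right) measureReal_nonneg⟩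
  have hle : ∀ i, condEntAlg μ (dirKronAlg μ T β) α
      ≤ ∑ A ∈ α, ∑ D ∈ η, μ.real D * Real.negMulLog (v A D i) := by
    intro i
    refine Finset.sum_le_sum fun A hA => ?_
    refine le_trans (le_of_eq ?_) (integral_negMulLog_le_sum hη (hETm A (w i)) (hET01 A hA (w i)))
    have hae : AEStronglyMeasurable (fun x => Real.negMulLog (E A x)) (μ.map (T (w i))) := by
      rw [(hmp (w i)).map_eq]
      exact Real.continuous_negMulLog.comp_aestronglyMeasurable (hEm A)
    have h1 := integral_map (hmp (w i)).measurable.aemeasurable hae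
    rwa [(hmp (w i)).map_eq] at h1
  have hdiff : Tendsto (fun i => ∑ A ∈ α, ∑ D ∈ η,
      μ.real D * (Real.negMulLog (u A D i) - Real.negMulLog (v A D i))) atTop (𝓝 0) := by
    have h0 : (0 : ℝ) = ∑ A ∈ α, ∑ D ∈ η, μ.real D * 0 := by simp
    rw [h0]
    refine tendsto_finsetSum _ fun A hA => tendsto_finsetSum _ fun D hD => ?_
    refine (tendsto_negMulLog_sub (hu A D) (fun i => setIntegral_div_mem_Icc (hETm A (w i))
      (hET01 A hA (w i)) D) ?_).const_mul _
    have h1 := (hlim A hA D hD).div_const (μ.real D)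
    rw [zero_div] at h1
    exact h1.congr fun i => sub_div _ _ _
  have hcond : ∀ i, condEntPart μ (pullPart T (w i) α) η
      = ∑ A ∈ α, ∑ D ∈ η, μ.real D * Real.negMulLog (u A D i) := fun i =>
    condEntPart_pullPart (hsurj (w i)) α η
  have hbdd : Filter.IsBoundedUnder (· ≤ ·) atTop
      fun i => condEntPart μ (pullPart T (w i) α) η := by
    refine Filter.isBoundedUnder_of ⟨∑ _A ∈ α, ∑ D ∈ η, μ.real D * 1, fun i => ?_⟩
    rw [hcond]
    exact Finset.sum_le_sum fun A _ => Finset.sum_le_sum fun D _ =>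
      mul_le_mul_of_nonneg_left (negMulLog_mem_Icc (hu A D i)).2 measureReal_nonneg
  refine le_of_forall_sub_le fun ε hε => ?_
  refine Filter.le_liminf_of_le hbdd.isCoboundedUnder_ge ?_
  filter_upwards [hdiff.eventually_const_lt (neg_lt_zero.2 hε)] with i hi
  simp only [mul_sub, Finset.sum_sub_distrib] at hi
  rw [hcond]
  linarith [hle i]

end Directional
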